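/- arXiv:1812.11895 — 3 statements merged into one kernel-verified Lean document; each statement's English description precedes it below -/
import Mathlib

section
/- Let G be a p-regular graph on n vertices and let κ, τ be nonnegative integers with τ > 0 and κ < p. Then G has a (κ,τ)-regular set S with S a proper subset of V(G) if and only if κ − τ is an eigenvalue of the adjacency matrix A_G and there exists a 0-1 vector x ∈ {0,1}^{V(G)} such that x − (τ/(p + τ − κ))·𝟙 lies in the eigenspace of A_G associated with κ − τ, where 𝟙 is the all-ones vector. Moreover, any such 0-1 vector x is the characteristic vector of a (κ,τ)-regular set of G. -/
open SimpleGraph Matrix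

/-- `S` is a `(κ,τ)`-regular set of `G`: every vertex in `S` has exactly `κ` neighbors in `S`
and every vertex outside `S` has exactly `τ` neighbors in `S`. -/
def IsKTRegular {V : Type*} (G : SimpleGraph V) (S : Set V) (κ τ : ℕ) : Prop :=
  (∀ v ∈ S, (G.neighborSet v ∩ S).ncard = κ) ∧ ∀ v ∉ S, (G.neighborSet v ∩ S).ncard = τ

/-- The characteristic (0-1) vector of a vertex subset. -/
noncomputable def charVec {V : Type*} (S : Set V) : V → ℝ := S.indicator 1

/-- `μ` is an eigenvalue of the real matrix `A`. -/
def IsAdjEigenvalue {n : ℕ} (A : Matrix (Fin n) (Fin n) ℝ) (μ : ℝ) : Prop :=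
  ∃ v : Fin n → ℝ, v ≠ 0 ∧ A.mulVec v = μ • v

theorem charVec_apply_of_mem {V : Type*} {S : Set V} {v : V} (hv : v ∈ S) : charVec S v = 1 := by
  simp [charVec, hv]

theorem charVec_apply_of_notMem {V : Type*} {S : Set V} {v : V} (hv : v ∉ S) :
    charVec S v = 0 := by
  simp [charVec, hv]

theorem charVec_setOf_eq_one {V : Type*} {x : V → ℝ} (hx : ∀ i, x i = 0 ∨ x i = 1) :
    charVec {i | x i = 1} = x := by
  ext i
  rcases hx i with h | h <;> simp [charVec, Set.indicator, h]

theorem adjMatrix_mulVec_charVec {V : Type*} [Fintype V] (G : SimpleGraph V)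
    [DecidableRel G.Adj] (S : Set V) (v : V) :
    (G.adjMatrix ℝ *ᵥ charVec S) v = ((G.neighborSet v ∩ S).ncard : ℝ) := by
  classical
  have h : G.neighborSet v ∩ S = ((G.neighborFinset v).filter (· ∈ S) : Finset V) := by
    ext w
    simp
  rw [adjMatrix_mulVec_apply, h, Set.ncard_coe_finset, Finset.card_filter]
  simp [charVec, Set.indicator]

theorem isKTRegular_iff_mulVec_charVec {V : Type*} [Fintype V] (G : SimpleGraph V)
    [DecidableRel G.Adj] (S : Set V) (κ τ : ℕ) :
    IsKTRegular G S κ τ ↔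
      ∀ v, (G.adjMatrix ℝ *ᵥ charVec S) v = ((κ : ℝ) - τ) * charVec S v + τ := by
  simp only [adjMatrix_mulVec_charVec]
  constructor
  · rintro ⟨hin, hout⟩ v
    by_cases hv : v ∈ S
    · simp [hin v hv, charVec_apply_of_mem hv]
    · simp [hout v hv, charVec_apply_of_notMem hv]
  · refine fun h => ⟨fun v hv => ?_, fun v hv => ?_⟩
    · simpa [charVec_apply_of_mem hv] using h v
    · simpa [charVec_apply_of_notMem hv] using h v

/-- In a `p`-regular graph the affine equation `A x = μ x + τ 𝟙` says that a shift of `x` by a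
multiple of `𝟙` lies in the eigenspace of `μ`. -/
theorem adjMatrix_mulVec_sub_smul_one_eq_iff {V : Type*} [Fintype V] {G : SimpleGraph V}
    [DecidableRel G.Adj] {p : ℕ} (hreg : G.IsRegularOfDegree p) {μ τ c : ℝ}
    (hc : c * (p - μ) = τ) (x : V → ℝ) :
    G.adjMatrix ℝ *ᵥ (x - c • (1 : V → ℝ)) = μ • (x - c • (1 : V → ℝ)) ↔
      ∀ v, (G.adjMatrix ℝ *ᵥ x) v = μ * x v + τ := by
  rw [funext_iff]
  refine forall_congr' fun v => ?_
  have hone : (G.adjMatrix ℝ *ᵥ (1 : V → ℝ)) v = p := by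
    simp [adjMatrix_mulVec_apply, hreg v]
  simp only [mulVec_sub, mulVec_smul, Pi.sub_apply, Pi.smul_apply, Pi.one_apply, smul_eq_mul, hone]
  exact ⟨fun h => by linear_combination h + hc, fun h => by linear_combination h - hc⟩

theorem IsKTRegular.ne_univ {V : Type*} [Fintype V] [Nonempty V] {G : SimpleGraph V}
    [DecidableRel G.Adj] {p κ τ : ℕ} {S : Set V} (h : IsKTRegular G S κ τ)
    (hreg : G.IsRegularOfDegree p) (hκ : κ < p) : S ≠ Set.univ := by
  rintro rfl
  obtain ⟨v⟩ := ‹Nonempty V›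
  have hv := h.1 v (Set.mem_univ v)
  rw [Set.inter_univ, ← coe_neighborFinset, Set.ncard_coe_finset, card_neighborFinset_eq_degree,
    hreg v] at hv
  omega

/-- Thompson's theorem: a `p`-regular graph has a proper `(κ,τ)`-regular set (with `τ > 0`,
`κ < p`) iff `κ - τ` is an adjacency eigenvalue and some 0-1 vector `x` is such that
`x - (τ/(p+τ-κ))·𝟙` lies in the eigenspace of `κ - τ`; moreover every such 0-1 vector is the
characteristic vector of a `(κ,τ)`-regular set. -/
theorem thompson_kt_regular {n p κ τ : ℕ} (G : SimpleGraph (Fin n)) [DecidableRel G.Adj]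
    (hreg : G.IsRegularOfDegree p) (hτ : 0 < τ) (hκ : κ < p) :
    ((∃ S : Set (Fin n), S ⊂ Set.univ ∧ IsKTRegular G S κ τ) ↔
      (IsAdjEigenvalue (G.adjMatrix ℝ) ((κ : ℝ) - τ) ∧
        ∃ x : Fin n → ℝ, (∀ i, x i = 0 ∨ x i = 1) ∧
          (G.adjMatrix ℝ).mulVec (x - ((τ : ℝ) / ((p : ℝ) + τ - κ)) • (1 : Fin n → ℝ)) =
            ((κ : ℝ) - τ) • (x - ((τ : ℝ) / ((p : ℝ) + τ - κ)) • (1 : Fin n → ℝ)))) ∧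
    ∀ x : Fin n → ℝ, (∀ i, x i = 0 ∨ x i = 1) →
      (G.adjMatrix ℝ).mulVec (x - ((τ : ℝ) / ((p : ℝ) + τ - κ)) • (1 : Fin n → ℝ)) =
        ((κ : ℝ) - τ) • (x - ((τ : ℝ) / ((p : ℝ) + τ - κ)) • (1 : Fin n → ℝ)) →
      ∃ S : Set (Fin n), IsKTRegular G S κ τ ∧ x = charVec S := by
  have hpos : (0 : ℝ) < (p : ℝ) + τ - κ := by
    have hκ' : (κ : ℝ) < p := by exact_mod_cast hκ
    have : (0 : ℝ) ≤ τ := τ.cast_nonneg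
    linarith
  set c : ℝ := (τ : ℝ) / ((p : ℝ) + τ - κ) with hc
  have hc_ne : c ≠ 0 := div_ne_zero (by exact_mod_cast hτ.ne') hpos.ne'
  have hcp : c * (p - ((κ : ℝ) - τ)) = τ := by
    rw [sub_sub_eq_add_sub, hc, div_mul_cancel₀ _ hpos.ne']
  simp only [adjMatrix_mulVec_sub_smul_one_eq_iff hreg hcp]
  have hset : ∀ x : Fin n → ℝ, (∀ i, x i = 0 ∨ x i = 1) →
      (∀ v, (G.adjMatrix ℝ *ᵥ x) v = ((κ : ℝ) - τ) * x v + τ) →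
      ∃ S : Set (Fin n), IsKTRegular G S κ τ ∧ x = charVec S := by
    intro x hx h
    have hS := charVec_setOf_eq_one hx
    exact ⟨{i | x i = 1}, (isKTRegular_iff_mulVec_charVec G _ κ τ).2 (by rwa [hS]), hS.symm⟩
  refine ⟨⟨?_, ?_⟩, hset⟩
  · rintro ⟨S, hS, hkt⟩
    have h := (isKTRegular_iff_mulVec_charVec G S κ τ).1 hkt
    refine ⟨⟨charVec S - c • (1 : Fin n → ℝ), fun h0 => ?_,
      (adjMatrix_mulVec_sub_smul_one_eq_iff hreg hcp _).2 h⟩, charVec S, fun i => ?_, h⟩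
    · obtain ⟨v, hv⟩ := (Set.ne_univ_iff_exists_notMem S).1 hS.ne
      exact hc_ne (by simpa [charVec_apply_of_notMem hv] using congrFun h0 v)
    · by_cases hi : i ∈ S
      · exact Or.inr (charVec_apply_of_mem hi)
      · exact Or.inl (charVec_apply_of_notMem hi)
  · rintro ⟨⟨v, hv, -⟩, x, hx, h⟩
    obtain ⟨i, -⟩ := Function.ne_iff.1 hv
    have : Nonempty (Fin n) := ⟨i⟩
    obtain ⟨S, hS, -⟩ := hset x hx h
    exact ⟨S, Set.ssubset_univ_iff.2 (hS.ne_univ hreg hκ), hS⟩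
end

section
/- Let G be a graph of order n with minimum degree δ(G) and maximum degree Δ(G), and let S be a (κ,τ)-regular set of G with S a proper subset of V(G), τ > 0, and δ(G) + τ > κ. Then nτ/(Δ(G) − (κ − τ)) ≤ |S| ≤ nτ/(δ(G) − (κ − τ)). -/
open SimpleGraph Matrix

/-- Double counting of the edges between `S` and the whole vertex set: the numbers of neighbors
in `S`, summed over all vertices, add up to the degree sum over `S`. -/
theorem sum_ncard_neighborSet_inter {V : Type*} [Fintype V] (G : SimpleGraph V)
    [DecidableRel G.Adj] (S : Set V) [DecidablePred (· ∈ S)] :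
    ∑ v, (G.neighborSet v ∩ S).ncard = ∑ u ∈ S.toFinset, G.degree u := by
  classical
  have h : ∀ v, (G.neighborSet v ∩ S).ncard = (S.toFinset.bipartiteAbove G.Adj v).card := by
    intro v
    rw [← Set.ncard_coe_finset]
    congr 1
    ext u
    simp [Finset.bipartiteAbove, and_comm]
  simp_rw [h]
  rw [Finset.sum_card_bipartiteAbove_eq_sum_card_bipartiteBelow]
  refine Finset.sum_congr rfl fun u _ => ?_
  rw [← G.card_neighborFinset_eq_degree]
  congr 1
  ext v
  simp [Finset.bipartiteBelow, G.adj_comm]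

/-- The degree sum over a `(κ,τ)`-regular set `S` is `κ|S| + τ(n - |S|)`. -/
theorem IsKTRegular.sum_degree_add {V : Type*} [Fintype V] {G : SimpleGraph V}
    [DecidableRel G.Adj] {S : Set V} [DecidablePred (· ∈ S)] {κ τ : ℕ}
    (h : IsKTRegular G S κ τ) :
    ∑ u ∈ S.toFinset, G.degree u + S.ncard * τ = S.ncard * κ + Fintype.card V * τ := by
  classical
  have hin : ∑ v ∈ S.toFinset, (G.neighborSet v ∩ S).ncard = S.ncard * κ := by
    rw [Finset.sum_congr rfl fun v hv => h.1 v (Set.mem_toFinset.1 hv), Finset.sum_const,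
      smul_eq_mul, Set.ncard_eq_toFinset_card']
  have hout : ∑ v ∈ S.toFinsetᶜ, (G.neighborSet v ∩ S).ncard = S.toFinsetᶜ.card * τ := by
    rw [Finset.sum_congr rfl fun v hv => h.2 v (by simpa using hv), Finset.sum_const,
      smul_eq_mul]
  rw [← sum_ncard_neighborSet_inter, ← Finset.sum_add_sum_compl S.toFinset, hin, hout,
    ← Finset.card_add_card_compl S.toFinset, Set.ncard_eq_toFinset_card']
  ring

/-- Cardinality bounds for a proper `(κ,τ)`-regular set `S` of a graph `G` of order `n`:
`nτ/(Δ(G) - (κ-τ)) ≤ |S| ≤ nτ/(δ(G) - (κ-τ))`. -/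
theorem kt_regular_card_bounds {n κ τ : ℕ} (G : SimpleGraph (Fin n)) [DecidableRel G.Adj]
    (S : Set (Fin n)) (hS : S ⊂ Set.univ) (hkt : IsKTRegular G S κ τ)
    (hτ : 0 < τ) (hδ : κ < G.minDegree + τ) :
    ((n : ℝ) * τ) / ((G.maxDegree : ℝ) - ((κ : ℝ) - τ)) ≤ (S.ncard : ℝ) ∧
      (S.ncard : ℝ) ≤ ((n : ℝ) * τ) / ((G.minDegree : ℝ) - ((κ : ℝ) - τ)) := by
  classical
  have hsum := hkt.sum_degree_add
  rw [Fintype.card_fin] at hsum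
  have hle : S.ncard * G.minDegree ≤ ∑ u ∈ S.toFinset, G.degree u := by
    rw [Set.ncard_eq_toFinset_card', ← smul_eq_mul]
    exact Finset.card_nsmul_le_sum _ _ _ fun u _ => G.minDegree_le_degree u
  have hge : ∑ u ∈ S.toFinset, G.degree u ≤ S.ncard * G.maxDegree := by
    rw [Set.ncard_eq_toFinset_card', ← smul_eq_mul]
    exact Finset.sum_le_card_nsmul _ _ _ fun u _ => G.degree_le_maxDegree u
  have hmin_le_max : (G.minDegree : ℝ) ≤ G.maxDegree := by
    exact_mod_cast G.minDegree_le_maxDegree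
  have hpos : (κ : ℝ) < G.minDegree + τ := by exact_mod_cast hδ
  have hlower : (S.ncard : ℝ) * κ + n * τ ≤ S.ncard * G.maxDegree + S.ncard * τ := by
    exact_mod_cast hsum ▸ Nat.add_le_add_right hge _
  have hupper : (S.ncard : ℝ) * G.minDegree + S.ncard * τ ≤ S.ncard * κ + n * τ := by
    exact_mod_cast hsum ▸ Nat.add_le_add_right hle _
  constructor
  · rw [div_le_iff₀ (by linarith)]
    linarith
  · rw [le_div_iff₀ (by linarith)]
    linarith
end

section
/- Let G be a graph with a (κ,τ)-regular set S which is a proper subset of V(G), with τ > 0, and let x̄ be a particular solution of the linear system (A_G − (κ − τ)I_n)x = τ·𝟙. If μ is a main eigenvalue of G and û is an eigenvector of A_G for μ with ûᵀ𝟙 ≠ 0, then ûᵀx̄ ≠ 0 and μ = τ·(ûᵀ𝟙)/(ûᵀx̄) + (κ − τ). -/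
open SimpleGraph Matrix

/-- `μ` is a main eigenvalue of `A`: the eigenspace of `μ` is not orthogonal to the
all-ones vector, i.e. there is an eigenvector `u` for `μ` with `uᵀ𝟙 ≠ 0`. -/
def IsMainEigenvalue {n : ℕ} (A : Matrix (Fin n) (Fin n) ℝ) (μ : ℝ) : Prop :=
  ∃ u : Fin n → ℝ, u ≠ 0 ∧ A.mulVec u = μ • u ∧ dotProduct u (fun _ => (1 : ℝ)) ≠ 0

/-- If `G` has a proper `(κ,τ)`-regular set (`τ > 0`), `x̄` is a particular solution of
`(A_G - (κ-τ)I)x = τ𝟙`, `μ` is a main eigenvalue of `G` and `û` an eigenvector for `μ` with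
`ûᵀ𝟙 ≠ 0`, then `ûᵀx̄ ≠ 0` and `μ = τ·(ûᵀ𝟙)/(ûᵀx̄) + (κ - τ)`. -/
theorem main_eigenvalue_formula {n κ τ : ℕ} (G : SimpleGraph (Fin n)) [DecidableRel G.Adj]
    (S : Set (Fin n)) (hSproper : S ⊂ Set.univ) (hS : IsKTRegular G S κ τ) (hτ : 0 < τ)
    (xbar : Fin n → ℝ)
    (hxbar : (G.adjMatrix ℝ - ((κ : ℝ) - τ) • (1 : Matrix (Fin n) (Fin n) ℝ)).mulVec xbar =
      (τ : ℝ) • (1 : Fin n → ℝ))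
    (μ : ℝ) (hμ : IsMainEigenvalue (G.adjMatrix ℝ) μ)
    (u : Fin n → ℝ) (hune : u ≠ 0) (huev : (G.adjMatrix ℝ).mulVec u = μ • u)
    (hu1 : dotProduct u (1 : Fin n → ℝ) ≠ 0) :
    dotProduct u xbar ≠ 0 ∧
      μ = (τ : ℝ) * (dotProduct u (1 : Fin n → ℝ)) / (dotProduct u xbar) +
        ((κ : ℝ) - τ) := by
  have huA : u ᵥ* G.adjMatrix ℝ = μ • u := by
    rw [← huev, ← mulVec_transpose, transpose_adjMatrix]
  have key : (μ - ((κ : ℝ) - τ)) * (u ⬝ᵥ xbar) = τ * (u ⬝ᵥ 1) := by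
    have h := congrArg (u ⬝ᵥ ·) hxbar
    simp only [sub_mulVec, smul_mulVec, one_mulVec, dotProduct_sub, dotProduct_smul,
      dotProduct_mulVec, huA, smul_dotProduct, smul_eq_mul] at h
    rw [sub_mul, h]
  have hux : u ⬝ᵥ xbar ≠ 0 := by
    intro h0
    rw [h0, mul_zero] at key
    exact mul_ne_zero (Nat.cast_ne_zero.mpr hτ.ne') hu1 key.symm
  refine ⟨hux, ?_⟩
  rw [← key, mul_div_cancel_right₀ _ hux, sub_add_cancel]
end
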